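/- Let H be a finitely generated additive abelian group and B : H × H → ℝ/ℤ a symmetric biadditive map. Then there exists a map τ : H → ℝ/ℤ such that B(c,c') = τ(c+c') − τ(c) − τ(c') for all c, c' ∈ H. -/

import Mathlib

/-- The underlying type `A × H` of the central extension of `H` by `A` with cocycle `B`. -/
@[ext]
structure CocycleExtension {H A : Type*} [AddCommGroup H] [AddCommGroup A]
    (B : H →+ H →+ A) where
  /-- The component in the kernel. -/
  fiber : A
  /-- The component in the quotient. -/
  base : H

namespace CocycleExtension

variable {H A : Type*} [AddCommGroup H] [AddCommGroup A] {B : H →+ H →+ A}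

instance : Add (CocycleExtension B) :=
  ⟨fun x y => ⟨x.fiber + y.fiber + B x.base y.base, x.base + y.base⟩⟩

instance : Zero (CocycleExtension B) := ⟨⟨0, 0⟩⟩

instance : Neg (CocycleExtension B) := ⟨fun x => ⟨-x.fiber + B x.base x.base, -x.base⟩⟩

theorem add_def (x y : CocycleExtension B) :
    x + y = ⟨x.fiber + y.fiber + B x.base y.base, x.base + y.base⟩ := rfl

theorem zero_def : (0 : CocycleExtension B) = ⟨0, 0⟩ := rfl

theorem neg_def (x : CocycleExtension B) :
    -x = ⟨-x.fiber + B x.base x.base, -x.base⟩ := rfl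

/-- The extension by a symmetric cocycle is commutative. -/
abbrev addCommGroup (hB : ∀ c c', B c c' = B c' c) : AddCommGroup (CocycleExtension B) where
  add_assoc x y z := by
    ext
    · simp only [add_def, map_add, AddMonoidHom.add_apply]; abel
    · simp only [add_def, add_assoc]
  zero_add x := by ext <;> simp [add_def, zero_def]
  add_zero x := by ext <;> simp [add_def, zero_def]
  neg_add_cancel x := by ext <;> simp [add_def, zero_def, neg_def]
  add_comm x y := by
    ext
    · simp only [add_def, hB x.base, add_comm x.fiber]
    · simp only [add_def, add_comm x.base]
  nsmul := nsmulRec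
  zsmul := zsmulRec

end CocycleExtension

/-- A symmetric biadditive map with values in a divisible group is a coboundary: the commutative
extension it defines splits. -/
theorem exists_coboundary_of_symmetric {H A : Type*} [AddCommGroup H] [AddCommGroup A]
    [DivisibleBy A ℤ] (B : H →+ H →+ A) (hB : ∀ c c', B c c' = B c' c) :
    ∃ τ : H → A, ∀ c c', B c c' = τ (c + c') - τ c - τ c' := by
  let := CocycleExtension.addCommGroup hB
  let i : A →+ CocycleExtension B :=
    { toFun := fun a => ⟨a, 0⟩
      map_zero' := rfl
      map_add' := fun a a' => by simp [CocycleExtension.add_def] }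
  have hi : Function.Injective i := fun a a' h => congrArg CocycleExtension.fiber h
  obtain ⟨r, hr⟩ :=
    (Module.Baer.of_divisible A).extension_property_addMonoidHom i hi (AddMonoidHom.id A)
  refine ⟨fun c => -r ⟨0, c⟩, fun c c' => ?_⟩
  have hri : r (i (B c c')) = B c c' := DFunLike.congr_fun hr _
  have hsum : (⟨0, c⟩ : CocycleExtension B) + ⟨0, c'⟩ = i (B c c') + ⟨0, c + c'⟩ := by
    simp [i, CocycleExtension.add_def]
  have h := congrArg r hsum
  rw [map_add, map_add, hri] at h
  rw [eq_sub_of_add_eq h.symm, sub_neg_eq_add, sub_neg_eq_add, sub_eq_neg_add, add_assoc]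

/-- Let `H` be a finitely generated abelian group and `B : H × H → ℝ/ℤ` a symmetric
biadditive map. Then there is `τ : H → ℝ/ℤ` such that
`B(c,c') = τ(c+c') − τ(c) − τ(c')` for all `c, c'`. -/
theorem symmetric_biadditive_coboundary_of_fg {H : Type*} [AddCommGroup H]
    (hfg : AddGroup.FG H) (B : H → H → AddCircle (1 : ℝ))
    (hB_left : ∀ c c' d : H, B (c + c') d = B c d + B c' d)
    (hB_right : ∀ c d d' : H, B c (d + d') = B c d + B c d')
    (hB_symm : ∀ c c' : H, B c c' = B c' c) :
    ∃ τ : H → AddCircle (1 : ℝ), ∀ c c' : H, B c c' = τ (c + c') - τ c - τ c' := by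
  let β : H →+ H →+ AddCircle (1 : ℝ) :=
    AddMonoidHom.mk' (fun c => AddMonoidHom.mk' (B c) (hB_right c))
      fun c c' => AddMonoidHom.ext (hB_left c c')
  exact exists_coboundary_of_symmetric β hB_symm
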